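/- Quadratic evolution equation for the Cauchy–Jost function (Eq. (new21)): fix k ∈ {1,…,K}, λ, μ ∈ ℂ with λ, μ ∉ {κ_1,…,κ_N} and μ ≠ λ, and a point x⁰ ∈ ℝ^K with det(C' E(x⁰)^{−1} V') ≠ 0. Then the map x ↦ f(x,λ,μ) (defined on the open set where det(C' E(x)^{−1} V') ≠ 0) has a partial derivative with respect to x_k at x⁰, and ∂f/∂x_k (x⁰,λ,μ) = − ∑_{n=1}^N f(x⁰,λ,κ_n) (κ_n^k / r_n) f(x⁰,κ_n,μ). -/

import Mathlib

open Finset Matrix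

noncomputable section

/-- `rProd κ n = ∏_{m ≠ n} (κ n - κ m)`. -/
def rProd {N : ℕ} (κ : Fin N → ℝ) (n : Fin N) : ℝ :=
  ∏ m ∈ Finset.univ.erase n, (κ n - κ m)

/-- `Rpoly κ z = ∏_{n=1}^N (z - κ n)`. -/
def Rpoly {N : ℕ} (κ : Fin N → ℝ) (z : ℂ) : ℂ :=
  ∏ n, (z - (κ n : ℂ))

/-- The incomplete Vandermonde matrix `V'`, of size `N × N_a`. -/
def Vmat' (Na Nb : ℕ) (κ : Fin (Na + Nb) → ℝ) : Matrix (Fin (Na + Nb)) (Fin Na) ℝ :=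
  Matrix.of fun n j => κ n ^ (j : ℕ)

/-- `e_n(x) = exp(∑_{k'=1}^K κ_n^{k'} x_{k'})`. -/
def evec {N : ℕ} (K : ℕ) (κ : Fin N → ℝ) (x : Fin K → ℝ) (n : Fin N) : ℝ :=
  Real.exp (∑ k' : Fin K, κ n ^ ((k' : ℕ) + 1) * x k')

/-- The matrix `C' E(x)⁻¹ V'`. -/
def Mmat (Na Nb K : ℕ) (κ : Fin (Na + Nb) → ℝ) (C' : Matrix (Fin Na) (Fin (Na + Nb)) ℝ)
    (x : Fin K → ℝ) : Matrix (Fin Na) (Fin Na) ℝ :=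
  C' * Matrix.diagonal (fun n => (evec K κ x n)⁻¹) * Vmat' Na Nb κ

/-- The Cauchy–Jost function
`f(x,λ,μ) = R(μ)/(μ−λ) − R(μ) ∑_j λ^{j−1} ∑_m ((C'E(x)⁻¹V')⁻¹ C'E(x)⁻¹)_{j,m}/(μ−κ_m)`. -/
def fFun (Na Nb K : ℕ) (κ : Fin (Na + Nb) → ℝ) (C' : Matrix (Fin Na) (Fin (Na + Nb)) ℝ)
    (x : Fin K → ℝ) (lam mu : ℂ) : ℂ :=
  Rpoly κ mu / (mu - lam) -
    Rpoly κ mu * ∑ j : Fin Na, lam ^ (j : ℕ) *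
      ∑ m : Fin (Na + Nb),
        ((((Mmat Na Nb K κ C' x)⁻¹ * C' *
            Matrix.diagonal (fun n => (evec K κ x n)⁻¹)) j m : ℝ) : ℂ) / (mu - (κ m : ℂ))

/-- The value `f(x,λ,κ_n) = −∑_j λ^{j−1} ((C'E(x)⁻¹V')⁻¹ C' r E(x)⁻¹)_{j,n}`. -/
def fKap (Na Nb K : ℕ) (κ : Fin (Na + Nb) → ℝ) (C' : Matrix (Fin Na) (Fin (Na + Nb)) ℝ)
    (x : Fin K → ℝ) (lam : ℂ) (n : Fin (Na + Nb)) : ℂ :=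
  - ∑ j : Fin Na, lam ^ (j : ℕ) *
      ((((Mmat Na Nb K κ C' x)⁻¹ * C' * Matrix.diagonal (rProd κ) *
          Matrix.diagonal (fun n' => (evec K κ x n')⁻¹)) j n : ℝ) : ℂ)

theorem hasDerivAt_matrix_mul_apply {l m n : Type*} [Fintype m] {A : ℝ → Matrix l m ℝ} {B : ℝ → Matrix m n ℝ}
    {A' : Matrix l m ℝ} {B' : Matrix m n ℝ} {t : ℝ}
    (hA : ∀ i j, HasDerivAt (fun s => A s i j) (A' i j) t)
    (hB : ∀ i j, HasDerivAt (fun s => B s i j) (B' i j) t) (i : l) (j : n) :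
    HasDerivAt (fun s => (A s * B s) i j) ((A' * B t + A t * B') i j) t := by
  simp only [Matrix.mul_apply, Matrix.add_apply, ← Finset.sum_add_distrib]
  exact HasDerivAt.fun_sum fun a _ => (hA i a).mul (hB a j)

attribute [local instance] Matrix.linftyOpNormedRing Matrix.linftyOpNormedAlgebra in
theorem hasDerivAt_matrix_inv_apply {n : Type*} [Fintype n] [DecidableEq n]
    {A : ℝ → Matrix n n ℝ} {A' : Matrix n n ℝ} {t : ℝ}
    (hA : ∀ i j, HasDerivAt (fun s => A s i j) (A' i j) t) (hdet : (A t).det ≠ 0)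
    (i j : n) :
    HasDerivAt (fun s => (A s)⁻¹ i j) ((-((A t)⁻¹ * A' * (A t)⁻¹)) i j) t := by
  have hmat : HasDerivAt A A' t := by
    have h : HasDerivAt (fun s => ∑ a, ∑ b, A s a b • Matrix.single a b (1 : ℝ))
        (∑ a, ∑ b, A' a b • Matrix.single a b (1 : ℝ)) t :=
      HasDerivAt.fun_sum fun a _ => HasDerivAt.fun_sum fun b _ => (hA a b).smul_const _
    simpa [Matrix.smul_single, ← Matrix.matrix_eq_sum_single] using h
  have hunit : IsUnit (A t) := (Matrix.isUnit_iff_isUnit_det _).2 hdet.isUnit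
  obtain ⟨u, hu⟩ := hunit
  have hinv : HasFDerivAt Ring.inverse
      (-ContinuousLinearMap.mulLeftRight ℝ (Matrix n n ℝ) ↑u⁻¹ ↑u⁻¹) (A t) :=
    hu ▸ hasFDerivAt_ringInverse u
  have hentry := ((Matrix.entryLinearMap ℝ ℝ i j).toContinuousLinearMap.hasFDerivAt.comp_hasDerivAt
    t (hinv.comp_hasDerivAt t hmat))
  have hu' : (↑u⁻¹ : Matrix n n ℝ) = (A t)⁻¹ := by
    rw [← hu, Matrix.coe_units_inv]
  simp only [Matrix.nonsing_inv_eq_ringInverse] at hu' ⊢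
  refine HasDerivAt.congr_deriv hentry ?_
  simp [hu']
  rfl

theorem hasDerivAt_inv_mul_apply {l m : Type*} [Fintype l] [Fintype m] [DecidableEq l]
    {P : ℝ → Matrix l m ℝ} {P' : Matrix l m ℝ}
    {V : Matrix m l ℝ} {t : ℝ} (hP : ∀ i j, HasDerivAt (fun s => P s i j) (P' i j) t)
    (hdet : (P t * V).det ≠ 0) (i : l) (j : m) :
    HasDerivAt (fun s => ((P s * V)⁻¹ * P s) i j)
      (((P t * V)⁻¹ * P' - (P t * V)⁻¹ * P' * V * ((P t * V)⁻¹ * P t)) i j) t := by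
  have hPV : ∀ a b, HasDerivAt (fun s => (P s * V) a b) ((P' * V) a b) t := fun a b => by
    simpa using hasDerivAt_matrix_mul_apply (B := fun _ => V) (B' := 0) hP
      (fun a b => hasDerivAt_const _ _) a b
  convert hasDerivAt_matrix_mul_apply (fun a b => hasDerivAt_matrix_inv_apply hPV hdet a b) hP i j
    using 2
  simp only [Matrix.neg_mul, Matrix.mul_assoc]
  rw [sub_eq_neg_add]

theorem hasDerivAt_evec_inv {N K : ℕ} (κ : Fin N → ℝ) (x : Fin K → ℝ) (k : Fin K) (n : Fin N) :
    HasDerivAt (fun t => (evec K κ (Function.update x k t) n)⁻¹)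
      (-(κ n ^ ((k : ℕ) + 1) * (evec K κ x n)⁻¹)) (x k) := by
  have hsum : HasDerivAt
      (fun t => -∑ k' : Fin K, κ n ^ ((k' : ℕ) + 1) * Function.update x k t k')
      (-(κ n ^ ((k : ℕ) + 1))) (x k) := by
    have h := (HasDerivAt.fun_sum fun (k' : Fin K) (_ : k' ∈ Finset.univ) =>
      ((hasDerivAt_pi.1 (hasDerivAt_update x k (x k)) k').const_mul (κ n ^ ((k' : ℕ) + 1)))).neg
    refine HasDerivAt.congr_deriv h ?_
    simp [Pi.single_apply]
  simp only [evec, ← Real.exp_neg]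
  simpa [mul_comm] using hsum.exp

theorem rProd_ne_zero {N : ℕ} {κ : Fin N → ℝ} (hκ : Function.Injective κ) (n : Fin N) :
    rProd κ n ≠ 0 :=
  Finset.prod_ne_zero_iff.2 fun _ hm =>
    sub_ne_zero.2 fun h => (Finset.mem_erase.1 hm).1 (hκ h).symm

/-- The coefficient matrix `(C' E(x)⁻¹ V')⁻¹ C' E(x)⁻¹` of the Cauchy–Jost function. -/
def coeffMat (Na Nb K : ℕ) (κ : Fin (Na + Nb) → ℝ) (C' : Matrix (Fin Na) (Fin (Na + Nb)) ℝ)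
    (x : Fin K → ℝ) : Matrix (Fin Na) (Fin (Na + Nb)) ℝ :=
  (Mmat Na Nb K κ C' x)⁻¹ * C' * Matrix.diagonal (fun n => (evec K κ x n)⁻¹)

theorem hasDerivAt_coeffMat_apply {Na Nb K : ℕ} {κ : Fin (Na + Nb) → ℝ}
    {C' : Matrix (Fin Na) (Fin (Na + Nb)) ℝ} {x : Fin K → ℝ} (k : Fin K)
    (hdet : (Mmat Na Nb K κ C' x).det ≠ 0) (j : Fin Na) (m : Fin (Na + Nb)) :
    HasDerivAt (fun t => coeffMat Na Nb K κ C' (Function.update x k t) j m)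
      ((∑ n, coeffMat Na Nb K κ C' x j n * κ n ^ ((k : ℕ) + 1) *
          ∑ i : Fin Na, κ n ^ (i : ℕ) * coeffMat Na Nb K κ C' x i m) -
        coeffMat Na Nb K κ C' x j m * κ m ^ ((k : ℕ) + 1)) (x k) := by
  set D : Matrix (Fin (Na + Nb)) (Fin (Na + Nb)) ℝ :=
    Matrix.diagonal fun n => κ n ^ ((k : ℕ) + 1)
  set P : (Fin K → ℝ) → Matrix (Fin Na) (Fin (Na + Nb)) ℝ :=
    fun y => C' * Matrix.diagonal (fun n => (evec K κ y n)⁻¹)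
  have hcoeff : ∀ y, coeffMat Na Nb K κ C' y = (P y * Vmat' Na Nb κ)⁻¹ * P y := fun y =>
    Matrix.mul_assoc _ _ _
  have hP : ∀ a b, HasDerivAt (fun t => P (Function.update x k t) a b)
      ((-(P x * D)) a b) (x k) := fun a b => by
    have h := (hasDerivAt_evec_inv κ x k b).const_mul (C' a b)
    have hPapply : ∀ y, P y a b = C' a b * (evec K κ y b)⁻¹ := fun y =>
      Matrix.mul_diagonal (fun n => (evec K κ y n)⁻¹) C' a b
    rw [Matrix.neg_apply, Matrix.mul_diagonal]
    simp only [hPapply]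
    refine HasDerivAt.congr_deriv h ?_
    ring
  have hdetP : (P (Function.update x k (x k)) * Vmat' Na Nb κ).det ≠ 0 := by
    rw [Function.update_eq_self]
    exact hdet
  clear_value P
  have h := hasDerivAt_inv_mul_apply (P := fun t => P (Function.update x k t))
    (V := Vmat' Na Nb κ) hP hdetP j m
  simp only [Function.update_eq_self] at h
  simp only [hcoeff]
  refine HasDerivAt.congr_deriv h (Eq.symm ?_)
  rw [Matrix.mul_neg, ← Matrix.mul_assoc, Matrix.neg_mul, Matrix.neg_mul, sub_neg_eq_add,
    neg_add_eq_sub, Matrix.mul_assoc _ (Vmat' Na Nb κ), Matrix.sub_apply,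
    Matrix.mul_apply (M := _ * D)]
  simp only [D, Matrix.mul_diagonal]
  rfl

theorem fKap_eq {Na Nb K : ℕ} (κ : Fin (Na + Nb) → ℝ) (C' : Matrix (Fin Na) (Fin (Na + Nb)) ℝ)
    (x : Fin K → ℝ) (lam : ℂ) (n : Fin (Na + Nb)) :
    fKap Na Nb K κ C' x lam n =
      -(∑ j : Fin Na, lam ^ (j : ℕ) * (coeffMat Na Nb K κ C' x j n : ℂ)) * (rProd κ n : ℂ) := by
  simp only [fKap, coeffMat, Matrix.mul_diagonal, neg_mul, Finset.sum_mul]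
  congr 1
  refine Finset.sum_congr rfl fun j _ => ?_
  push_cast
  ring

/-- Quadratic evolution equation for the Cauchy–Jost function (Eq. (new21)):
`∂f/∂x_k (x⁰,λ,μ) = − ∑_n f(x⁰,λ,κ_n) (κ_n^k / r_n) f(x⁰,κ_n,μ)`. -/
theorem cauchyJost_time_evolution (Na Nb : ℕ) (hNa : 1 ≤ Na) (hNb : 1 ≤ Nb)
    (κ : Fin (Na + Nb) → ℝ) (hκ : StrictMono κ)
    (C' : Matrix (Fin Na) (Fin (Na + Nb)) ℝ) (hC' : C'.rank = Na)
    (K : ℕ) (hK : 1 ≤ K) (k : Fin K)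
    (lam mu : ℂ) (hlam : ∀ n, lam ≠ (κ n : ℂ)) (hmu : ∀ n, mu ≠ (κ n : ℂ))
    (hmulam : mu ≠ lam)
    (x0 : Fin K → ℝ) (hdet : (Mmat Na Nb K κ C' x0).det ≠ 0) :
    HasDerivAt (fun t : ℝ => fFun Na Nb K κ C' (Function.update x0 k t) lam mu)
      (- ∑ n, fKap Na Nb K κ C' x0 lam n *
          (((κ n ^ ((k : ℕ) + 1) / rProd κ n) : ℝ) : ℂ) *
          fFun Na Nb K κ C' x0 ((κ n : ℝ) : ℂ) mu)
      (x0 k) := by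
  have hW := hasDerivAt_coeffMat_apply k hdet
  have hf := ((HasDerivAt.fun_sum fun (j : Fin Na) (_ : j ∈ Finset.univ) =>
    (HasDerivAt.fun_sum fun (m : Fin (Na + Nb)) (_ : m ∈ Finset.univ) =>
      ((hW j m).ofReal_comp.div_const (mu - (κ m : ℂ)))).const_mul
        (lam ^ (j : ℕ))).const_mul (Rpoly κ mu)).const_sub (Rpoly κ mu / (mu - lam))
  refine HasDerivAt.congr_deriv hf (Eq.symm ?_)
  have hsummand : ∀ n, fKap Na Nb K κ C' x0 lam n *
      (((κ n ^ ((k : ℕ) + 1) / rProd κ n) : ℝ) : ℂ) * fFun Na Nb K κ C' x0 ((κ n : ℝ) : ℂ) mu =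
      Rpoly κ mu * ∑ j : Fin Na, lam ^ (j : ℕ) *
        ((∑ m, (coeffMat Na Nb K κ C' x0 j n * (κ n : ℂ) ^ ((k : ℕ) + 1) *
          ∑ i : Fin Na, (κ n : ℂ) ^ (i : ℕ) * coeffMat Na Nb K κ C' x0 i m) / (mu - (κ m : ℂ))) -
        coeffMat Na Nb K κ C' x0 j n * (κ n : ℂ) ^ ((k : ℕ) + 1) / (mu - (κ n : ℂ))) := fun n => by
    have hr : (rProd κ n : ℂ) ≠ 0 := by exact_mod_cast rProd_ne_zero hκ.injective n
    have hinner : ∑ i : Fin Na, (κ n : ℂ) ^ (i : ℕ) *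
        ∑ m, (coeffMat Na Nb K κ C' x0 i m : ℂ) / (mu - (κ m : ℂ)) =
        ∑ m, (∑ i : Fin Na, (κ n : ℂ) ^ (i : ℕ) * coeffMat Na Nb K κ C' x0 i m) /
          (mu - (κ m : ℂ)) := by
      simp only [Finset.mul_sum, Finset.sum_div, mul_div_assoc]
      exact Finset.sum_comm
    have hfFun : fFun Na Nb K κ C' x0 ((κ n : ℝ) : ℂ) mu =
        Rpoly κ mu / (mu - κ n) - Rpoly κ mu * ∑ m, (∑ i : Fin Na, (κ n : ℂ) ^ (i : ℕ) *
          coeffMat Na Nb K κ C' x0 i m) / (mu - (κ m : ℂ)) := by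
      rw [← hinner]; rfl
    rw [hfFun, fKap_eq]
    simp only [mul_div_assoc, ← Finset.mul_sum]
    generalize (∑ m, (∑ i : Fin Na, (κ n : ℂ) ^ (i : ℕ) *
      coeffMat Na Nb K κ C' x0 i m) / (mu - (κ m : ℂ))) = S
    push_cast
    rw [neg_mul, neg_mul, neg_mul, Finset.sum_mul, Finset.sum_mul, Finset.sum_mul,
      ← Finset.sum_neg_distrib, Finset.mul_sum]
    refine Finset.sum_congr rfl fun j _ => ?_
    field_simp
    ring
  simp only [hsummand]
  rw [← Finset.mul_sum, Finset.sum_comm]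
  congr 2
  refine Finset.sum_congr rfl fun j _ => ?_
  rw [← Finset.mul_sum, Finset.sum_sub_distrib, Finset.sum_comm, ← Finset.sum_sub_distrib]
  push_cast
  simp only [sub_div, Finset.sum_div]

end
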